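/- The restriction to the subgroup G of the homomorphism ι : M04 → PSL(2,ℤ) (determined by ι(σ1) = ι(σ3) = [A], ι(σ2) = [B] with A = !![1,1; 0,1] and B = !![1,0; -1,1]) is an isomorphism from G onto PSL(2,ℤ). -/

import Mathlib

/-- `SL(2,ℤ)`: 2×2 integer matrices of determinant 1. -/
abbrev SL2Z := Matrix.SpecialLinearGroup (Fin 2) ℤ

/-- The matrix `A = !![1,1; 0,1]` as an element of `SL(2,ℤ)`. -/
def MA : SL2Z := ⟨!![1, 1; 0, 1], by norm_num [Matrix.det_fin_two_of]⟩

/-- The matrix `B = !![1,0; -1,1]` as an element of `SL(2,ℤ)`. -/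
def MB : SL2Z := ⟨!![1, 0; -1, 1], by norm_num [Matrix.det_fin_two_of]⟩

/-- `PSL(2,ℤ)`: the quotient of `SL(2,ℤ)` by its center `{±1}`. -/
abbrev PSL2Z := SL2Z ⧸ Subgroup.center SL2Z

/-- Relations for the presented group
`M04 = ⟨σ1, σ2, σ3 | σ1σ3 = σ3σ1, σ1σ2σ1 = σ2σ1σ2, σ3σ2σ3 = σ2σ3σ2,
(σ1σ2σ3)⁴ = 1, σ1σ2σ3²σ2σ1 = 1⟩`, a presentation of the mapping class group of
the 4-punctured sphere, with `σ1, σ2, σ3` corresponding to `0, 1, 2`. -/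
def m4Rels : Set (FreeGroup (Fin 3)) :=
  { FreeGroup.of 0 * FreeGroup.of 2 * (FreeGroup.of 2 * FreeGroup.of 0)⁻¹,
    FreeGroup.of 0 * FreeGroup.of 1 * FreeGroup.of 0 *
      (FreeGroup.of 1 * FreeGroup.of 0 * FreeGroup.of 1)⁻¹,
    FreeGroup.of 2 * FreeGroup.of 1 * FreeGroup.of 2 *
      (FreeGroup.of 1 * FreeGroup.of 2 * FreeGroup.of 1)⁻¹,
    (FreeGroup.of 0 * FreeGroup.of 1 * FreeGroup.of 2) ^ 4,
    FreeGroup.of 0 * FreeGroup.of 1 * FreeGroup.of 2 ^ 2 * FreeGroup.of 1 * FreeGroup.of 0 }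

/-- The mapping class group of the 4-punctured sphere, by its presentation. -/
abbrev M04 := PresentedGroup m4Rels

/-- The generator `σ1` of `M04`. -/
def m4s1 : M04 := PresentedGroup.of 0

/-- The generator `σ2` of `M04`. -/
def m4s2 : M04 := PresentedGroup.of 1

/-- The generator `σ3` of `M04`. -/
def m4s3 : M04 := PresentedGroup.of 2

/-- The element `a = σ1σ3⁻¹` of `M04`. -/
def ea : M04 := m4s1 * m4s3⁻¹

/-- The element `b = σ2σ1σ3⁻¹σ2⁻¹` of `M04`. -/
def eb : M04 := m4s2 * m4s1 * m4s3⁻¹ * m4s2⁻¹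

/-- The subgroup `N` of `M04` generated by `a` and `b`. -/
def Nsub : Subgroup M04 := Subgroup.closure {ea, eb}

/-- The subgroup `G` of `M04` generated by `σ1` and `σ2`. -/
def Gsub : Subgroup M04 := Subgroup.closure {m4s1, m4s2}

theorem aux_y3 {H : Type*} [Group H] (a b c : H) (h1 : a * c = c * a)
    (h2 : a * b * a = b * a * b) (h3 : c * b * c = b * c * b)
    (h4 : (a * b * c) ^ 4 = 1) (h5 : a * b * c ^ 2 * b * a = 1) :
    (a * b) * (a * b) * (a * b) = 1 := by
  have e2 : (a * b * c) * (a * b * c) = (a * b) * (a * b) * c * b := by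
    calc (a * b * c) * (a * b * c) = a * b * (c * a) * b * c := by simp only [mul_assoc]
      _ = a * b * (a * c) * b * c := by rw [h1]
      _ = a * b * a * (c * b * c) := by simp only [mul_assoc]
      _ = a * b * a * (b * c * b) := by rw [h3]
      _ = _ := by simp only [mul_assoc]
  have e3 : (a * b * c) * (a * b * c) * (a * b * c)
      = (a * b) * (a * b) * (a * b) * c * b * a := by
    calc (a * b * c) * (a * b * c) * (a * b * c)
        = (a * b) * (a * b) * c * b * (a * b * c) := by rw [e2]
      _ = (a * b) * (a * b) * c * (b * a * b) * c := by simp only [mul_assoc]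
      _ = (a * b) * (a * b) * c * (a * b * a) * c := by rw [h2]
      _ = (a * b) * (a * b) * (c * a) * b * (a * c) := by simp only [mul_assoc]
      _ = (a * b) * (a * b) * (a * c) * b * (c * a) := by rw [h1]
      _ = (a * b) * (a * b) * a * (c * b * c) * a := by simp only [mul_assoc]
      _ = (a * b) * (a * b) * a * (b * c * b) * a := by rw [h3]
      _ = _ := by simp only [mul_assoc]
  have e4 : (a * b) * (a * b) * (a * b) * (c * b * a * a * b * c) = 1 := by
    calc (a * b) * (a * b) * (a * b) * (c * b * a * a * b * c)
        = ((a * b) * (a * b) * (a * b) * c * b * a) * (a * b * c) := by simp only [mul_assoc]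
      _ = (a * b * c) ^ 4 := by rw [← e3, pow_succ, pow_succ, pow_two]
      _ = 1 := h4
  have e5 : c * b * a * a * b * c = 1 := by
    have : c * c = b⁻¹ * a⁻¹ * a⁻¹ * b⁻¹ := by
      have h : a * b * (c * c) * (b * a) = 1 := by
        rw [← h5]; simp only [mul_assoc, pow_two]
      calc c * c = (a * b)⁻¹ * (a * b * (c * c) * (b * a)) * (b * a)⁻¹ := by group
        _ = _ := by rw [h]; group
    calc c * b * a * a * b * c = c * (b * a * a * b * (c * c)) * c⁻¹ := by group
      _ = 1 := by rw [this]; group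
  rwa [e5, mul_one] at e4

theorem m4_comm : m4s1 * m4s3 = m4s3 * m4s1 := by
  rw [← mul_inv_eq_one]
  exact PresentedGroup.one_of_mem (rels := m4Rels) (by simp [m4Rels])

theorem m4_braid : m4s1 * m4s2 * m4s1 = m4s2 * m4s1 * m4s2 := by
  rw [← mul_inv_eq_one]
  exact PresentedGroup.one_of_mem (rels := m4Rels) (by simp [m4Rels])

theorem m4_braid2 : m4s3 * m4s2 * m4s3 = m4s2 * m4s3 * m4s2 := by
  rw [← mul_inv_eq_one]
  exact PresentedGroup.one_of_mem (rels := m4Rels) (by simp [m4Rels])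

theorem m4_rel4 : (m4s1 * m4s2 * m4s3) ^ 4 = 1 :=
  PresentedGroup.one_of_mem (rels := m4Rels) (by simp [m4Rels])

theorem m4_rel5 : m4s1 * m4s2 * m4s3 ^ 2 * m4s2 * m4s1 = 1 :=
  PresentedGroup.one_of_mem (rels := m4Rels) (by simp [m4Rels])

theorem m4_y3 : (m4s1 * m4s2) * (m4s1 * m4s2) * (m4s1 * m4s2) = 1 :=
  aux_y3 _ _ _ m4_comm m4_braid m4_braid2 m4_rel4 m4_rel5

/-- `x = σ1σ2σ1`. -/
def mx : M04 := m4s1 * m4s2 * m4s1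

/-- `y = σ1σ2`. -/
def my : M04 := m4s1 * m4s2

theorem my3 : my * my * my = 1 := m4_y3

theorem mx2 : mx * mx = 1 := by
  rw [← m4_y3]
  calc mx * mx = m4s1 * m4s2 * m4s1 * (m4s1 * m4s2 * m4s1) := rfl
    _ = m4s1 * m4s2 * m4s1 * (m4s2 * m4s1 * m4s2) := by rw [m4_braid]
    _ = _ := by simp only [mul_assoc]

theorem my_inv : my⁻¹ = my * my := by
  rw [inv_eq_iff_mul_eq_one, ← mul_assoc]; exact my3

theorem mx_inv : mx⁻¹ = mx := by
  rw [inv_eq_iff_mul_eq_one]; exact mx2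

theorem s1_eq : m4s1 = my * my * mx := by
  rw [← my_inv]; simp only [mx, my]; group

theorem s2inv_eq : m4s2⁻¹ = my * mx := by
  have h : my * mx * m4s2 = 1 := by
    rw [← my3]; simp only [mx, my, mul_assoc]
  exact (eq_inv_of_mul_eq_one_left h).symm

/-- Positive words together with their matrices. -/
inductive Pos : M04 → SL2Z → Prop
  | one : Pos 1 1
  | stepP (m N) : Pos m N → Pos (m4s1 * m) (MA * N)
  | stepQ (m N) : Pos m N → Pos (m4s2⁻¹ * m) (MB⁻¹ * N)

theorem Pos.map {ι : M04 →* PSL2Z} (h1 : ι m4s1 = (QuotientGroup.mk MA : PSL2Z))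
    (h2 : ι m4s2 = (QuotientGroup.mk MB : PSL2Z)) {m : M04} {N : SL2Z} (h : Pos m N) :
    ι m = (QuotientGroup.mk N : PSL2Z) := by
  induction h with
  | one => rw [map_one]; rfl
  | stepP m N _ ih => rw [map_mul, h1, ih]; rfl
  | stepQ m N _ ih => rw [map_mul, map_inv, h2, ih]; rfl

theorem det_eq (N : SL2Z) : N.1 0 0 * N.1 1 1 - N.1 0 1 * N.1 1 0 = 1 := by
  have := N.2
  rwa [Matrix.det_fin_two] at this

theorem mulE (U V : SL2Z) (i j : Fin 2) :
    (U * V).1 i j = U.1 i 0 * V.1 0 j + U.1 i 1 * V.1 1 j := by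
  rw [Matrix.SpecialLinearGroup.coe_mul, Matrix.mul_apply, Fin.sum_univ_two]

theorem MAv : MA.1 = !![1, 1; 0, 1] := rfl

theorem MBv : MB.1 = !![1, 0; -1, 1] := rfl

theorem MBiv : (MB⁻¹).1 = !![1, 0; 1, 1] := by
  rw [Matrix.SpecialLinearGroup.coe_inv, MBv, Matrix.adjugate_fin_two_of]; simp

theorem Pos.entries {m : M04} {N : SL2Z} (h : Pos m N) :
    0 ≤ N.1 0 0 ∧ 0 ≤ N.1 0 1 ∧ 0 ≤ N.1 1 0 ∧ 0 ≤ N.1 1 1 ∧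
      (m = 1 ∨ 3 ≤ N.1 0 0 + N.1 0 1 + N.1 1 0 + N.1 1 1) := by
  induction h with
  | one => simp
  | stepP m N _ ih =>
    obtain ⟨a, b, c, d, -⟩ := ih
    have hd := det_eq N
    have h : 0 < N.1 0 0 * N.1 1 1 := by nlinarith [mul_nonneg b c]
    have ha : 0 < N.1 0 0 := lt_of_le_of_ne a (by rintro h'; rw [← h'] at h; simp at h)
    have hd : 0 < N.1 1 1 := lt_of_le_of_ne d (by rintro h'; rw [← h'] at h; simp at h)
    simp only [mulE, MAv]
    simp
    omega
  | stepQ m N _ ih =>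
    obtain ⟨a, b, c, d, -⟩ := ih
    have hd := det_eq N
    have h : 0 < N.1 0 0 * N.1 1 1 := by nlinarith [mul_nonneg b c]
    have ha : 0 < N.1 0 0 := lt_of_le_of_ne a (by rintro h'; rw [← h'] at h; simp at h)
    have hd : 0 < N.1 1 1 := lt_of_le_of_ne d (by rintro h'; rw [← h'] at h; simp at h)
    simp only [mulE, MBiv]
    simp
    omega

/-- Normal forms. -/
def NF (g : M04) : Prop :=
  ∃ m N β, Pos m N ∧ (β = 1 ∨ β = my ∨ β = my * my) ∧ (g = m * β ∨ g = mx * (m * β))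

theorem NF.x {g : M04} (h : NF g) : NF (mx * g) := by
  obtain ⟨m, N, β, hm, hβ, rfl | rfl⟩ := h
  · exact ⟨m, N, β, hm, hβ, Or.inr rfl⟩
  · exact ⟨m, N, β, hm, hβ, Or.inl (by rw [← mul_assoc, mx2, one_mul])⟩

theorem NF.y {g : M04} (h : NF g) : NF (my * g) := by
  obtain ⟨m, N, β, hm, hβ, rfl | rfl⟩ := h
  · cases hm with
    | one =>
      rcases hβ with rfl | rfl | rfl
      · exact ⟨1, 1, my, .one, by simp, by simp⟩
      · exact ⟨1, 1, my * my, .one, by simp, by simp⟩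
      · exact ⟨1, 1, 1, .one, by simp, by left; rw [one_mul, one_mul, ← mul_assoc, my3]⟩
    | stepP m N hm =>
      refine ⟨m, N, β, hm, hβ, Or.inr ?_⟩
      rw [s1_eq]
      calc my * (my * my * mx * m * β) = my * my * my * (mx * (m * β)) := by
            simp only [mul_assoc]
        _ = _ := by rw [my3, one_mul]
    | stepQ m N hm =>
      refine ⟨_, _, β, .stepP m N hm, hβ, Or.inl ?_⟩
      rw [s1_eq, s2inv_eq]
      simp only [mul_assoc]
  · refine ⟨_, _, β, .stepQ m N hm, hβ, Or.inl ?_⟩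
    rw [s2inv_eq]
    simp only [mul_assoc]

theorem NF.all {g : M04} (h : g ∈ Gsub) : NF g := by
  have s2 : m4s2 = mx * (my * my) := by
    rw [← my_inv, ← inv_inj, s2inv_eq, mul_inv_rev, inv_inv, mx_inv]
  unfold Gsub at h
  induction h using Subgroup.closure_induction_left with
  | one => exact ⟨1, 1, 1, .one, by simp, by simp⟩
  | mul_left a ha b _ ih =>
    rcases ha with rfl | rfl
    · rw [s1_eq]; simp only [mul_assoc]; exact ih.x.y.y
    · rw [s2]; simp only [mul_assoc]; exact ih.y.y.x
  | inv_mul_cancel a ha b _ ih =>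
    rcases ha with rfl | rfl
    · rw [s1_eq, ← my_inv, mul_inv_rev, inv_inv, mx_inv]
      simp only [mul_assoc]; exact ih.y.x
    · rw [s2inv_eq]; simp only [mul_assoc]; exact ih.x.y

theorem mk_one {U : SL2Z} (h : (QuotientGroup.mk U : PSL2Z) = 1) :
    U.1 0 1 = 0 ∧ U.1 1 0 = 0 ∧ U.1 0 0 = U.1 1 1 := by
  rw [QuotientGroup.eq_one_iff, Subgroup.mem_center_iff] at h
  have a00 := congrArg (fun V : SL2Z => V.1 0 0) (h MA)
  have a01 := congrArg (fun V : SL2Z => V.1 0 1) (h MA)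
  have b00 := congrArg (fun V : SL2Z => V.1 0 0) (h MB)
  simp only [mulE, MAv, MBv] at a00 a01 b00
  simp at a00 a01 b00
  omega

theorem NF.ker {ι : M04 →* PSL2Z} (h1 : ι m4s1 = (QuotientGroup.mk MA : PSL2Z))
    (h2 : ι m4s2 = (QuotientGroup.mk MB : PSL2Z)) {g : M04} (h : NF g) (hg : ι g = 1) :
    g = 1 := by
  obtain ⟨m, N, β, hm, hβ, hg'⟩ := h
  have hN := hm.map h1 h2
  obtain ⟨a, b, c, d, e⟩ := hm.entries
  have hdet := det_eq N
  have hx : ι mx = (QuotientGroup.mk (MA * MB * MA) : PSL2Z) := by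
    simp only [mx, map_mul, h1, h2]; rfl
  have hy : ι my = (QuotientGroup.mk (MA * MB) : PSL2Z) := by
    simp only [my, map_mul, h1, h2]; rfl
  have main : ∀ V W : SL2Z, ι g = (QuotientGroup.mk (V * (N * W)) : PSL2Z) →
      (V * (N * W)).1 0 1 = 0 ∧ (V * (N * W)).1 1 0 = 0 ∧
        (V * (N * W)).1 0 0 = (V * (N * W)).1 1 1 :=
    fun V W h => mk_one (h.symm.trans hg)
  have fin1 : ∀ V W : SL2Z, ι g = (QuotientGroup.mk (V * (N * W)) : PSL2Z) →
      (V = 1 ∨ V = MA * MB * MA) → (W = 1 ∨ W = MA * MB ∨ W = MA * MB * (MA * MB)) →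
      V = 1 ∧ W = 1 ∧ m = 1 := by
    intro V W h hV hW
    have hm := main V W h
    rcases hV with rfl | rfl <;> rcases hW with rfl | rfl | rfl <;>
      simp only [mulE, MAv, MBv] at hm <;> simp at hm
    · refine ⟨rfl, rfl, e.resolve_right ?_⟩
      intro e
      obtain ⟨u, v, w⟩ := hm
      rw [u, v, w] at hdet
      rw [u, v, w] at e
      nlinarith
    all_goals
      exfalso
      obtain ⟨u, v, w⟩ := hm
      have : N.1 0 0 = 0 ∨ N.1 1 1 = 0 := by omega
      have : N.1 0 1 = 0 ∨ N.1 1 0 = 0 := by omega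
      have k1 : N.1 0 0 * N.1 1 1 = 0 := mul_eq_zero.2 ‹N.1 0 0 = 0 ∨ N.1 1 1 = 0›
      have k2 : N.1 0 1 * N.1 1 0 = 0 := mul_eq_zero.2 this
      rw [k1, k2] at hdet
      omega
  rcases hg' with rfl | rfl <;> rcases hβ with rfl | rfl | rfl
  · have := fin1 1 1 (by rw [one_mul, mul_one, mul_one, hN]) (by simp) (by simp)
    rw [this.2.2, mul_one]
  · have := fin1 1 (MA * MB) (by rw [map_mul, one_mul, hN, hy]; rfl) (by simp) (by simp)
    exact absurd (congrArg (fun U : SL2Z => U.1 0 1) this.2.1) (by decide)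
  · have := fin1 1 (MA * MB * (MA * MB)) (by rw [map_mul, map_mul, one_mul, hN, hy]; rfl)
      (by simp) (by simp)
    exact absurd (congrArg (fun U : SL2Z => U.1 0 1) this.2.1) (by decide)
  · have := fin1 (MA * MB * MA) 1 (by rw [map_mul, mul_one, mul_one, hN, hx]; rfl)
      (by simp) (by simp)
    exact absurd (congrArg (fun U : SL2Z => U.1 0 1) this.1) (by decide)
  · have := fin1 (MA * MB * MA) (MA * MB) (by rw [map_mul, map_mul, hN, hx, hy]; rfl)
      (by simp) (by simp)
    exact absurd (congrArg (fun U : SL2Z => U.1 0 1) this.1) (by decide)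
  · have := fin1 (MA * MB * MA) (MA * MB * (MA * MB))
      (by rw [map_mul, map_mul, map_mul, hN, hx, hy]; rfl) (by simp) (by simp)
    exact absurd (congrArg (fun U : SL2Z => U.1 0 1) this.1) (by decide)

theorem stmt10 :
    ∀ ι : M04 →* PSL2Z,
      ι m4s1 = (QuotientGroup.mk MA : PSL2Z) →
      ι m4s2 = (QuotientGroup.mk MB : PSL2Z) →
      ι m4s3 = (QuotientGroup.mk MA : PSL2Z) →
      Function.Bijective (fun x : Gsub => ι x) := by
  intro ι h1 h2 _
  constructor
  · have : Function.Injective (ι.comp Gsub.subtype) := by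
      rw [injective_iff_map_eq_one]
      rintro ⟨g, hg⟩ h
      exact Subtype.ext ((NF.all hg).ker h1 h2 h)
    exact this
  · have m1 : m4s1 ∈ Gsub := Subgroup.subset_closure (by simp)
    have m2 : m4s2 ∈ Gsub := Subgroup.subset_closure (by simp)
    have key : ∀ U : SL2Z, (QuotientGroup.mk U : PSL2Z) ∈ Gsub.map ι := by
      intro U
      have hU : U ∈ Subgroup.closure {ModularGroup.S, ModularGroup.T} := by
        rw [SpecialLinearGroup.SL2Z_generators]; trivial
      have hle : Subgroup.closure {ModularGroup.S, ModularGroup.T} ≤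
          (Gsub.map ι).comap (QuotientGroup.mk' (Subgroup.center SL2Z)) := by
        rw [Subgroup.closure_le]
        rintro _ (rfl | rfl)
        · refine ⟨mx⁻¹, inv_mem (mul_mem (mul_mem m1 m2) m1), ?_⟩
          have : ModularGroup.S = (MA * MB * MA)⁻¹ := by
            decide
          rw [this]
          simp only [mx, map_inv, map_mul, h1, h2]; rfl
        · refine ⟨m4s1, m1, ?_⟩
          have : ModularGroup.T = MA := rfl
          rw [h1, this]; rfl
      exact hle hU
    intro q
    induction q using QuotientGroup.induction_on with
    | H U =>
      obtain ⟨g, hg, h⟩ := key U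
      exact ⟨⟨g, hg⟩, h⟩
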